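/- arXiv:2305.19562 — 2 statements merged into one kernel-verified Lean document; each statement's English description precedes it below -/
import Mathlib

section
/- Let q ∈ (1/2, 1), ε ∈ (0, q - 1/2), ρ ∈ (0, 1), and let m ≥ 1 be an integer. Let (Ω, μ) be a probability space and A : {0,1}^m × Ω → {0,1} a measurable map, interpreted as a randomized algorithm A(x; r) acting on a sample sequence x with internal random seed r. Assume: (i) (replicability) if p ~ Uniform[q-ε, q], and conditionally on p the sequences x, x' are two independent samples from Ber(p)^m, and independently r ~ μ, then P[A(x; r) ≠ A(x'; r)] ≤ ρ; (ii) (correctness) P_{x ~ Ber(q-ε)^m, r ~ μ}[A(x; r) = 0] ≥ 23/24 and P_{x ~ Ber(q)^m, r ~ μ}[A(x; r) = 1] ≥ 23/24. Then m ≥ (64/6561) · q(1-q) / (ε² ρ²). -/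
open MeasureTheory

/-- The Bernoulli measure on `Bool` with probability `p` of `true`. -/
noncomputable def bern (p : ℝ) : Measure Bool :=
  ENNReal.ofReal p • Measure.dirac true + ENNReal.ofReal (1 - p) • Measure.dirac false

/-- The law of `m` i.i.d. `Ber(p)` coin flips: the product measure `Ber(p)^m`. -/
noncomputable def coinSeq (m : ℕ) (p : ℝ) : Measure (Fin m → Bool) :=
  Measure.pi fun _ => bern p

/-- The uniform probability measure on the interval `[a, b]`. -/
noncomputable def unifIcc (a b : ℝ) : Measure ℝ :=
  (ENNReal.ofReal (b - a))⁻¹ • volume.restrict (Set.Icc a b)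

/-- The mass that `Ber(p)` gives to `b`. -/
noncomputable def bernWeight (p : ℝ) (b : Bool) : ℝ := if b then p else 1 - p

/-- The derivative in `p` of the log-likelihood of a single flip `b`. -/
noncomputable def bernScore (p : ℝ) (b : Bool) : ℝ := if b then p⁻¹ else -(1 - p)⁻¹

/-- The mass that `Ber(p)^m` gives to the sequence `x`. -/
noncomputable def seqWeight {m : ℕ} (p : ℝ) (x : Fin m → Bool) : ℝ := ∏ i, bernWeight p (x i)

/-- The derivative in `p` of the log-likelihood of the sequence `x`. -/
noncomputable def seqScore {m : ℕ} (p : ℝ) (x : Fin m → Bool) : ℝ := ∑ i, bernScore p (x i)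

/-- The probability that the deterministic test `B` outputs `true` on `Ber(p)^m`. -/
noncomputable def acceptProb {m : ℕ} (B : (Fin m → Bool) → Bool) (p : ℝ) : ℝ :=
  ∑ x, seqWeight p x * if B x then 1 else 0

section Score

variable {m : ℕ} {p : ℝ}

lemma bernWeight_nonneg (hp : p ∈ Set.Icc (0 : ℝ) 1) (b : Bool) : 0 ≤ bernWeight p b := by
  cases b <;> simp [bernWeight, hp.1, hp.2]

lemma seqWeight_nonneg (hp : p ∈ Set.Icc (0 : ℝ) 1) (x : Fin m → Bool) : 0 ≤ seqWeight p x :=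
  Finset.prod_nonneg fun i _ => bernWeight_nonneg hp (x i)

lemma sum_seqWeight_mul_prod (p : ℝ) (g : Fin m → Bool → ℝ) :
    ∑ x, seqWeight p x * ∏ i, g i (x i) = ∏ i, (p * g i true + (1 - p) * g i false) := by
  have h := Finset.sum_prod_piFinset (Finset.univ : Finset Bool)
    fun i b => bernWeight p b * g i b
  rw [Fintype.piFinset_univ] at h
  simpa only [seqWeight, Finset.prod_mul_distrib, Fintype.sum_bool, bernWeight, if_true,
    Bool.false_eq_true, if_false] using h

lemma sum_seqWeight (p : ℝ) : ∑ x : Fin m → Bool, seqWeight p x = 1 := by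
  simpa using sum_seqWeight_mul_prod p fun (_ : Fin m) _ => 1

lemma sum_seqWeight_mul_seqScore (hp : p ∈ Set.Ioo (0 : ℝ) 1) :
    ∑ x : Fin m → Bool, seqWeight p x * seqScore p x = 0 := by
  have hp0 : p ≠ 0 := hp.1.ne'
  have hp1 : 1 - p ≠ 0 := (sub_pos.2 hp.2).ne'
  simp_rw [seqScore, Finset.mul_sum]
  rw [Finset.sum_comm]
  refine Finset.sum_eq_zero fun i _ => ?_
  have h := sum_seqWeight_mul_prod p fun (k : Fin m) b => if i = k then bernScore p b else 1
  simp only [Finset.prod_ite_eq, Finset.mem_univ, if_true] at h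
  rw [h]
  refine Finset.prod_eq_zero (Finset.mem_univ i) ?_
  simp [bernScore, hp0, hp1]

lemma sum_seqWeight_mul_seqScore_sq (hp : p ∈ Set.Ioo (0 : ℝ) 1) :
    ∑ x : Fin m → Bool, seqWeight p x * seqScore p x ^ 2 = m / (p * (1 - p)) := by
  have hp0 : p ≠ 0 := hp.1.ne'
  have hp1 : 1 - p ≠ 0 := (sub_pos.2 hp.2).ne'
  have key : ∀ i j : Fin m, ∑ x : Fin m → Bool,
      seqWeight p x * (bernScore p (x i) * bernScore p (x j)) =
        if i = j then 1 / (p * (1 - p)) else 0 := by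
    intro i j
    have h := sum_seqWeight_mul_prod p fun (k : Fin m) b =>
      (if i = k then bernScore p b else 1) * if j = k then bernScore p b else 1
    simp only [Finset.prod_mul_distrib, Finset.prod_ite_eq, Finset.mem_univ, if_true] at h
    rw [h]
    split_ifs with hij
    · subst hij
      rw [Finset.prod_eq_single i (fun k _ hk => by simp [hk.symm]) (by simp)]
      simp [bernScore]
      field_simp
      ring
    · refine Finset.prod_eq_zero (Finset.mem_univ i) ?_
      simp [bernScore, hp0, hp1, Ne.symm hij]
  simp_rw [seqScore, sq, Finset.sum_mul_sum, Finset.mul_sum]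
  rw [Finset.sum_comm]
  simp_rw [Finset.sum_comm (s := (Finset.univ : Finset (Fin m → Bool))), key]
  simp [div_eq_mul_inv]

lemma hasDerivAt_seqWeight (hp : p ∈ Set.Ioo (0 : ℝ) 1) (x : Fin m → Bool) :
    HasDerivAt (fun p => seqWeight p x) (seqWeight p x * seqScore p x) p := by
  have hp0 : p ≠ 0 := hp.1.ne'
  have hp1 : 1 - p ≠ 0 := (sub_pos.2 hp.2).ne'
  have h1 : ∀ b, HasDerivAt (fun p => bernWeight p b) (bernWeight p b * bernScore p b) p := by
    rintro (_ | _)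
    · simpa [bernWeight, bernScore, hp1] using (hasDerivAt_id' p).const_sub 1
    · simpa [bernWeight, bernScore, hp0] using hasDerivAt_id' p
  refine (HasDerivAt.fun_finsetProd (u := Finset.univ) fun i _ => h1 (x i)).congr_deriv ?_
  rw [seqScore, Finset.mul_sum]
  refine Finset.sum_congr rfl fun i hi => ?_
  rw [seqWeight, ← Finset.mul_prod_erase _ _ hi, smul_eq_mul]
  ring

lemma hasDerivAt_acceptProb (hp : p ∈ Set.Ioo (0 : ℝ) 1) (B : (Fin m → Bool) → Bool) :
    HasDerivAt (acceptProb B)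
      (∑ x, seqWeight p x * seqScore p x * if B x then 1 else 0) p :=
  HasDerivAt.fun_sum fun x _ => (hasDerivAt_seqWeight hp x).mul_const _

lemma acceptProb_nonneg (hp : p ∈ Set.Icc (0 : ℝ) 1) (B : (Fin m → Bool) → Bool) :
    0 ≤ acceptProb B p :=
  Finset.sum_nonneg fun x _ => mul_nonneg (seqWeight_nonneg hp x) (by split_ifs <;> norm_num)

lemma acceptProb_le_one (hp : p ∈ Set.Icc (0 : ℝ) 1) (B : (Fin m → Bool) → Bool) :
    acceptProb B p ≤ 1 := by
  rw [← sum_seqWeight (m := m) p]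
  exact Finset.sum_le_sum fun x _ =>
    mul_le_of_le_one_right (seqWeight_nonneg hp x) (by split_ifs <;> norm_num)

lemma continuous_acceptProb (B : (Fin m → Bool) → Bool) : Continuous (acceptProb B) := by
  have h : ∀ b, Continuous fun p => bernWeight p b := by
    rintro (_ | _) <;> simp only [bernWeight, Bool.false_eq_true, if_true, if_false] <;> fun_prop
  have h' : ∀ x : Fin m → Bool, Continuous fun p => seqWeight p x := fun x =>
    continuous_finsetProd _ fun i _ => h (x i)
  exact continuous_finsetSum _ fun x _ => (h' x).mul_const _

/-- An upper bound on the Fisher information bounds the speed of an acceptance probability. -/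
lemma deriv_acceptProb_le (hp : p ∈ Set.Ioo (0 : ℝ) 1) (B : (Fin m → Bool) → Bool) {K : ℝ}
    (hK : 0 < K) (hmK : m / (p * (1 - p)) ≤ K ^ 2) :
    ∑ x, seqWeight p x * seqScore p x * (if B x then 1 else 0) ≤ K / 2 := by
  calc ∑ x, seqWeight p x * seqScore p x * (if B x then 1 else 0)
    _ = ∑ x, seqWeight p x * (seqScore p x * ((if B x then 1 else 0) - 1 / 2)) := by
      have h : ∀ x, seqWeight p x * (seqScore p x * ((if B x then 1 else 0) - 1 / 2)) =
          seqWeight p x * seqScore p x * (if B x then 1 else 0)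
            - 1 / 2 * (seqWeight p x * seqScore p x) := fun x => by ring
      simp_rw [h, Finset.sum_sub_distrib, ← Finset.mul_sum, sum_seqWeight_mul_seqScore hp]
      simp
    _ ≤ ∑ x, seqWeight p x * (K / 4 + seqScore p x ^ 2 / (4 * K)) := by
      refine Finset.sum_le_sum fun x _ =>
        mul_le_mul_of_nonneg_left ?_ (seqWeight_nonneg (Set.Ioo_subset_Icc_self hp) x)
      have e : K / 4 + seqScore p x ^ 2 / (4 * K) = (K ^ 2 + seqScore p x ^ 2) / (4 * K) := by
        field_simp
      rw [e, le_div_iff₀ (by positivity)]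
      split_ifs
      · nlinarith [sq_nonneg (seqScore p x - K)]
      · nlinarith [sq_nonneg (seqScore p x + K)]
    _ = K / 4 + m / (p * (1 - p)) / (4 * K) := by
      simp_rw [mul_add, Finset.sum_add_distrib, ← mul_div_assoc, ← Finset.sum_div,
        sum_seqWeight_mul_seqScore_sq hp, ← Finset.sum_mul, sum_seqWeight, one_mul]
    _ ≤ K / 4 + K ^ 2 / (4 * K) := by gcongr
    _ = K / 2 := by field_simp; ring

/-- A test whose acceptance probability moves from near `0` to near `1` must spend a
non-negligible range of biases at intermediate values. -/
lemma le_integral_acceptProb_mul {a b K : ℝ} (ha : 0 < a) (hab : a ≤ b) (hb : b < 1)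
    (B : (Fin m → Bool) → Bool) (hK : 0 < K)
    (hmK : ∀ p ∈ Set.Ioo a b, m / (p * (1 - p)) ≤ K ^ 2) :
    1 / 6 - (1 - acceptProb B b) / 4 - acceptProb B a / 4 ≤
      K / 2 * ∫ p in a..b, acceptProb B p * (1 - acceptProb B p) := by
  have hc := continuous_acceptProb B
  have hG := intervalIntegral.sub_le_integral_of_hasDeriv_right_of_le
    (g := fun p => acceptProb B p ^ 2 / 2 - acceptProb B p ^ 3 / 3)
    (g' := fun p => acceptProb B p * (1 - acceptProb B p) *
      ∑ x, seqWeight p x * seqScore p x * (if B x then 1 else 0))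
    (φ := fun p => K / 2 * (acceptProb B p * (1 - acceptProb B p))) hab
    (by fun_prop)
    (fun p hp => by
      have h := hasDerivAt_acceptProb ⟨ha.trans hp.1, hp.2.trans hb⟩ B
      refine ((((h.pow 2).div_const 2).sub ((h.pow 3).div_const 3)).congr_deriv
        ?_).hasDerivWithinAt
      push_cast
      ring)
    (Continuous.integrableOn_Icc (by fun_prop))
    (fun p hp => by
      have hp' : p ∈ Set.Ioo (0 : ℝ) 1 := ⟨ha.trans hp.1, hp.2.trans hb⟩
      have hp'' := Set.Ioo_subset_Icc_self hp'
      rw [mul_comm (K / 2)]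
      exact mul_le_mul_of_nonneg_left (deriv_acceptProb_le hp' B hK (hmK p hp))
        (mul_nonneg (acceptProb_nonneg hp'' B) (sub_nonneg.2 (acceptProb_le_one hp'' B))))
  rw [intervalIntegral.integral_const_mul] at hG
  refine le_trans ?_ hG
  have hbI : b ∈ Set.Icc (0 : ℝ) 1 := ⟨by linarith, hb.le⟩
  have haI : a ∈ Set.Icc (0 : ℝ) 1 := ⟨ha.le, by linarith⟩
  have h1 := acceptProb_nonneg haI B
  have h2 := acceptProb_le_one hbI B
  have h3 := acceptProb_nonneg hbI B
  have h4 := acceptProb_le_one haI B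
  generalize acceptProb B a = s at *
  generalize acceptProb B b = t at *
  have e1 : 1 / 6 - (1 - t) / 4 ≤ t ^ 2 / 2 - t ^ 3 / 3 := by
    nlinarith [mul_nonneg (sub_nonneg.2 h2) (sq_nonneg (t - 1 / 4))]
  have e2 : s ^ 2 / 2 - s ^ 3 / 3 ≤ s / 4 := by
    nlinarith [mul_nonneg h1 (sq_nonneg (s - 3 / 4))]
  linarith

end Score

section Measure

variable {m : ℕ} {p : ℝ}

instance (p : ℝ) : IsFiniteMeasure (bern p) := by
  refine ⟨?_⟩
  simp [bern]

lemma bern_singleton (p : ℝ) (b : Bool) : bern p {b} = ENNReal.ofReal (bernWeight p b) := by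
  cases b <;> simp [bern, bernWeight]

instance (m : ℕ) (p : ℝ) : IsFiniteMeasure (coinSeq m p) := by
  unfold coinSeq; infer_instance

lemma coinSeq_real_singleton (hp : p ∈ Set.Icc (0 : ℝ) 1) (x : Fin m → Bool) :
    (coinSeq m p).real {x} = seqWeight p x := by
  rw [Measure.real, coinSeq, Measure.pi_singleton, ENNReal.toReal_prod]
  refine Finset.prod_congr rfl fun i _ => ?_
  rw [bern_singleton, ENNReal.toReal_ofReal (bernWeight_nonneg hp _)]

lemma coinSeq_real_true (hp : p ∈ Set.Icc (0 : ℝ) 1) (B : (Fin m → Bool) → Bool) :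
    (coinSeq m p).real {x | B x = true} = acceptProb B p := by
  classical
  have h := sum_measureReal_singleton (μ := coinSeq m p)
    (Finset.univ.filter fun x => B x = true)
  simp only [Finset.coe_filter, Finset.mem_univ, true_and] at h
  rw [← h, acceptProb, Finset.sum_filter]
  refine Finset.sum_congr rfl fun x _ => ?_
  rw [coinSeq_real_singleton hp]
  split_ifs <;> simp

lemma coinSeq_real_univ (hp : p ∈ Set.Icc (0 : ℝ) 1) :
    (coinSeq m p).real Set.univ = 1 := by
  have h := coinSeq_real_true hp fun _ : Fin m → Bool => true
  simpa [acceptProb, sum_seqWeight] using h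

lemma coinSeq_real_false (hp : p ∈ Set.Icc (0 : ℝ) 1) (B : (Fin m → Bool) → Bool) :
    (coinSeq m p).real {x | B x = false} = 1 - acceptProb B p := by
  rw [← coinSeq_real_true hp, ← coinSeq_real_univ (m := m) hp,
    ← measureReal_compl (Set.toFinite _).measurableSet]
  congr 1
  ext x
  simp

lemma coinSeq_prod_real_ne (hp : p ∈ Set.Icc (0 : ℝ) 1) (B : (Fin m → Bool) → Bool) :
    ((coinSeq m p).prod (coinSeq m p)).real {z | B z.1 ≠ B z.2} =
      2 * (acceptProb B p * (1 - acceptProb B p)) := by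
  have h : {z : (Fin m → Bool) × (Fin m → Bool) | B z.1 ≠ B z.2} =
      {x | B x = true} ×ˢ {x | B x = false} ∪ {x | B x = false} ×ˢ {x | B x = true} := by
    ext ⟨x, y⟩
    cases hx : B x <;> cases hy : B y <;> simp [hx, hy]
  rw [h, measureReal_union _ (Set.toFinite _).measurableSet, measureReal_prod_prod,
    measureReal_prod_prod, coinSeq_real_true hp, coinSeq_real_false hp]
  · ring
  · rw [Set.disjoint_left]
    rintro ⟨x, y⟩ ⟨hx, _⟩ ⟨hx', _⟩
    simp_all

/-- Disintegration of a product measure along a finite-valued statistic of the second factor. -/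
lemma prod_real_eq_sum {X Ω β : Type*} [MeasurableSpace X] [Finite X] [MeasurableSingletonClass X]
    [MeasurableSpace Ω] [Fintype β] [MeasurableSpace β] [MeasurableSingletonClass β]
    (P : Measure X) [IsFiniteMeasure P] (μ : Measure Ω) [IsFiniteMeasure μ]
    {φ : Ω → β} (hφ : Measurable φ) (R : X → β → Prop) :
    (P.prod μ).real {w | R w.1 (φ w.2)} = ∑ b, μ.real (φ ⁻¹' {b}) * P.real {x | R x b} := by
  have h : {w : X × Ω | R w.1 (φ w.2)} =
      ⋃ b ∈ (Finset.univ : Finset β), {x | R x b} ×ˢ (φ ⁻¹' {b}) := by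
    ext ⟨x, r⟩
    simp
  rw [h, measureReal_biUnion_finset]
  · exact Finset.sum_congr rfl fun b _ => by rw [measureReal_prod_prod, mul_comm]
  · intro b _ c _ hbc
    rw [Function.onFun, Set.disjoint_left]
    rintro ⟨x, r⟩ ⟨_, hb⟩ ⟨_, hc⟩
    exact hbc (hb.symm.trans hc)
  · exact fun b _ => (Set.toFinite _).measurableSet.prod (hφ (measurableSet_singleton b))

end Measure

/-- sample complexity lower bound for a `ρ`-replicable randomized algorithm
`A(x; r)` for the single coin problem: if `A` is `ρ`-replicable over `p ~ Uniform[q-ε,q]`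
(two executions share the seed `r ~ μ` and use independent samples `x, x' ~ Ber(p)^m`),
and `A` is correct with probability `23/24` on biases `q-ε` (output `false`) and `q`
(output `true`), then `m ≥ (64/6561)·q(1-q)/(ε²ρ²)`. -/
theorem stmt_3 (q ε ρ : ℝ) (hq : q ∈ Set.Ioo (1 / 2 : ℝ) 1)
    (hε : ε ∈ Set.Ioo (0 : ℝ) (q - 1 / 2)) (hρ : ρ ∈ Set.Ioo (0 : ℝ) 1)
    (m : ℕ) (hm : 1 ≤ m)
    {Ω : Type*} [MeasurableSpace Ω] (μ : Measure Ω) [IsProbabilityMeasure μ]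
    (A : (Fin m → Bool) × Ω → Bool) (hA : Measurable A)
    (hrep : ∫ p, ((((coinSeq m p).prod (coinSeq m p)).prod μ)
        {w | A (w.1.1, w.2) ≠ A (w.1.2, w.2)}).toReal ∂(unifIcc (q - ε) q) ≤ ρ)
    (h0 : 23 / 24 ≤ (((coinSeq m (q - ε)).prod μ) {w | A w = false}).toReal)
    (h1 : 23 / 24 ≤ (((coinSeq m q).prod μ) {w | A w = true}).toReal) :
    (64 / 6561) * (q * (1 - q)) / (ε ^ 2 * ρ ^ 2) ≤ (m : ℝ) := by
  classical
  obtain ⟨hq0, hq1⟩ := hq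
  obtain ⟨hε0, hε1⟩ := hε
  have hρ0 := hρ.1
  let φ : Ω → (Fin m → Bool) → Bool := fun r x => A (x, r)
  have hφ : Measurable φ := measurable_pi_lambda _ fun x => hA.comp measurable_prodMk_left
  let c : ((Fin m → Bool) → Bool) → ℝ := fun B => μ.real (φ ⁻¹' {B})
  have hc0 : ∀ B, 0 ≤ c B := fun B => measureReal_nonneg
  have hc1 : ∑ B, c B = 1 := by
    have h := prod_real_eq_sum (Measure.dirac ()) μ hφ fun _ _ => True
    simpa using h.symm
  have haI : q - ε ∈ Set.Icc (0 : ℝ) 1 := ⟨by linarith, by linarith⟩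
  have hqI : q ∈ Set.Icc (0 : ℝ) 1 := ⟨by linarith, by linarith⟩
  have h0' : 23 / 24 ≤ ∑ B, c B * (1 - acceptProb B (q - ε)) := by
    have h := prod_real_eq_sum (coinSeq m (q - ε)) μ hφ fun x B => B x = false
    simp_rw [coinSeq_real_false haI] at h
    exact h0.trans h.le
  have h1' : 23 / 24 ≤ ∑ B, c B * acceptProb B q := by
    have h := prod_real_eq_sum (coinSeq m q) μ hφ fun x B => B x = true
    simp_rw [coinSeq_real_true hqI] at h
    exact h1.trans h.le
  have hrep' : 2 * ∑ B, c B * ∫ p in (q - ε)..q, acceptProb B p * (1 - acceptProb B p) ≤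
      ε * ρ := by
    have hdis : ∀ p ∈ Set.Icc (q - ε) q, ((((coinSeq m p).prod (coinSeq m p)).prod μ)
        {w | A (w.1.1, w.2) ≠ A (w.1.2, w.2)}).toReal =
          ∑ B, c B * (2 * (acceptProb B p * (1 - acceptProb B p))) := by
      intro p hp
      have hpI : p ∈ Set.Icc (0 : ℝ) 1 := ⟨haI.1.trans hp.1, hp.2.trans hqI.2⟩
      have h := prod_real_eq_sum ((coinSeq m p).prod (coinSeq m p)) μ hφ
        fun z B => B z.1 ≠ B z.2
      simp_rw [coinSeq_prod_real_ne hpI] at h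
      exact h
    rw [unifIcc, integral_smul_measure, setIntegral_congr_fun measurableSet_Icc hdis,
      integral_Icc_eq_integral_Ioc, ← intervalIntegral.integral_of_le (by linarith),
      intervalIntegral.integral_finsetSum] at hrep
    · simp_rw [intervalIntegral.integral_const_mul] at hrep
      rw [sub_sub_cancel, ENNReal.toReal_inv, ENNReal.toReal_ofReal hε0.le, smul_eq_mul,
        inv_mul_le_iff₀ hε0] at hrep
      rw [Finset.mul_sum]
      refine le_trans (Finset.sum_le_sum fun B _ => le_of_eq ?_) hrep
      ring
    · intro B _
      have := continuous_acceptProb B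
      exact Continuous.intervalIntegrable (by fun_prop) _ _
  have hqq : 0 < q * (1 - q) := mul_pos (by linarith) (by linarith)
  have hm0 : (0 : ℝ) < m := by exact_mod_cast hm
  set K : ℝ := √(m / (q * (1 - q))) with hKdef
  have hK : 0 < K := Real.sqrt_pos.2 (by positivity)
  have hKsq : K ^ 2 = m / (q * (1 - q)) := Real.sq_sqrt (by positivity)
  have hmK : ∀ p ∈ Set.Ioo (q - ε) q, m / (p * (1 - p)) ≤ K ^ 2 := by
    intro p hp
    rw [hKsq]
    have : q * (1 - q) ≤ p * (1 - p) := by nlinarith [hp.1, hp.2]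
    gcongr
  have hsum : ∑ B, c B * (1 / 6 - (1 - acceptProb B q) / 4 - acceptProb B (q - ε) / 4) ≤
      K / 2 * ∑ B, c B * ∫ p in (q - ε)..q, acceptProb B p * (1 - acceptProb B p) := by
    rw [Finset.mul_sum]
    refine Finset.sum_le_sum fun B _ => ?_
    rw [mul_left_comm]
    exact mul_le_mul_of_nonneg_left
      (le_integral_acceptProb_mul (by linarith) (by linarith) hq1 B hK hmK) (hc0 B)
  have hlow : ∑ B, c B * (1 / 6 - (1 - acceptProb B q) / 4 - acceptProb B (q - ε) / 4) =
      (∑ B, c B * acceptProb B q) / 4 + (∑ B, c B * (1 - acceptProb B (q - ε))) / 4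
        - (∑ B, c B) / 3 := by
    simp_rw [Finset.sum_div, ← Finset.sum_add_distrib, ← Finset.sum_sub_distrib]
    exact Finset.sum_congr rfl fun B _ => by ring
  have hmain : 7 / 12 ≤ K * (ε * ρ) := by
    rw [hlow, hc1] at hsum
    nlinarith [mul_le_mul_of_nonneg_left hrep' hK.le]
  have hmain2 : (7 / 12) ^ 2 ≤ K ^ 2 * (ε * ρ) ^ 2 := by
    rw [← mul_pow]
    exact pow_le_pow_left₀ (by norm_num) hmain 2
  rw [hKsq, div_mul_eq_mul_div, le_div_iff₀ hqq] at hmain2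
  rw [div_le_iff₀ (by positivity), ← mul_pow]
  linarith
end

section
/- Let d ≥ 1 be an integer and ε, ρ, δ ∈ (0,1). Set σ² = ε² / (8 log(4d/δ)). Let μ₁, μ₂ ∈ ℝ^d satisfy ‖μ₁ - μ₂‖_∞ ≤ ε ρ / √(8d log(4d/δ)). Then the product Gaussian measures P = N(μ₁, σ²I_d) and Q = N(μ₂, σ²I_d) on ℝ^d satisfy |P(E) - Q(E)| ≤ ρ/√2 for every Borel set E ⊆ ℝ^d. -/
open MeasureTheory ProbabilityTheory Finset

theorem gaussianReal_eq_withDensity_gaussianReal (m₁ m₂ : ℝ) {v : NNReal} (hv : v ≠ 0) :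
    gaussianReal m₁ v = (gaussianReal m₂ v).withDensity fun x ↦
      ENNReal.ofReal (Real.exp ((m₁ - m₂) / v * x - (m₁ ^ 2 - m₂ ^ 2) / (2 * v))) := by
  rw [gaussianReal_of_var_ne_zero _ hv, gaussianReal_of_var_ne_zero _ hv,
    ← withDensity_mul _ (measurable_gaussianPDF _ _) (by fun_prop)]
  congr 1
  ext x
  rw [Pi.mul_apply, gaussianPDF, gaussianPDF, ← ENNReal.ofReal_mul (gaussianPDFReal_nonneg _ _ _),
    gaussianPDFReal, gaussianPDFReal, mul_assoc _ (Real.exp _), ← Real.exp_add]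
  have hv' : (v : ℝ) ≠ 0 := by exact_mod_cast hv
  congr 3
  field_simp
  ring

theorem integrable_exp_affine_gaussianReal (m a b : ℝ) (v : NNReal) :
    Integrable (fun x ↦ Real.exp (a * x - b)) (gaussianReal m v) := by
  simp_rw [Real.exp_sub]
  exact (integrable_exp_mul_gaussianReal a).div_const _

theorem integral_exp_affine_gaussianReal (m a b : ℝ) (v : NNReal) :
    ∫ x, Real.exp (a * x - b) ∂gaussianReal m v = Real.exp (m * a + v * a ^ 2 / 2 - b) := by
  have h := congrFun (mgf_fun_id_gaussianReal (μ := m) (v := v)) a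
  simp only [mgf] at h
  simp_rw [Real.exp_sub _ b]
  rw [integral_div, h]

theorem integral_sq_density_gaussianReal (m₁ m₂ : ℝ) {v : NNReal} (hv : v ≠ 0) :
    ∫ x, Real.exp ((m₁ - m₂) / v * x - (m₁ ^ 2 - m₂ ^ 2) / (2 * v)) ^ 2 ∂gaussianReal m₂ v =
      Real.exp ((m₁ - m₂) ^ 2 / v) := by
  have hv' : (v : ℝ) ≠ 0 := by exact_mod_cast hv
  simp_rw [← Real.exp_nat_mul, mul_sub, ← mul_assoc]
  rw [integral_exp_affine_gaussianReal]
  congr 1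
  push_cast
  field_simp
  ring

theorem pi_withDensity_ofReal {ι : Type*} [Fintype ι] {X : ι → Type*}
    [∀ i, MeasurableSpace (X i)] (μ ν : ∀ i, Measure (X i)) [∀ i, SigmaFinite (μ i)]
    [∀ i, SigmaFinite (ν i)] (f : ∀ i, X i → ℝ) (hf0 : ∀ i x, 0 ≤ f i x)
    (hf : ∀ i, Integrable (f i) (ν i))
    (h : ∀ i, μ i = (ν i).withDensity fun x ↦ ENNReal.ofReal (f i x)) :
    Measure.pi μ = (Measure.pi ν).withDensity fun x ↦ ENNReal.ofReal (∏ i, f i (x i)) := by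
  refine (Measure.pi_eq fun s hs ↦ ?_)
  rw [withDensity_apply _ (MeasurableSet.univ_pi hs), Measure.restrict_pi_pi,
    ← ofReal_integral_eq_lintegral_ofReal
      (Integrable.fintype_prod_dep fun i ↦ (hf i).restrict)
      (ae_of_all _ fun x ↦ Finset.prod_nonneg fun i _ ↦ hf0 i _),
    integral_fintype_prod_eq_prod,
    ENNReal.ofReal_prod_of_nonneg fun i _ ↦ integral_nonneg (hf0 i)]
  refine Finset.prod_congr rfl fun i _ ↦ ?_
  rw [h i, withDensity_apply _ (hs i),
    ofReal_integral_eq_lintegral_ofReal (hf i).restrict (ae_of_all _ (hf0 i))]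

/-- The total variation distance is at most half the square root of the chi-squared divergence. -/
theorem four_mul_sq_setIntegral_sub_measureReal_le {Ω : Type*} [MeasurableSpace Ω]
    (Q : Measure Ω) [IsProbabilityMeasure Q] {f : Ω → ℝ} (hf : Integrable f Q)
    (hf2 : Integrable (fun x ↦ f x ^ 2) Q) (hf1 : ∫ x, f x ∂Q = 1) {E : Set Ω}
    (hE : MeasurableSet E) :
    4 * (∫ x in E, f x ∂Q - Q.real E) ^ 2 ≤ ∫ x, f x ^ 2 ∂Q - 1 := by
  set D := ∫ x in E, f x ∂Q - Q.real E with hD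
  have hg : Integrable (fun x ↦ f x - 1) Q := hf.sub (integrable_const 1)
  have hgE : Integrable (E.indicator fun x ↦ f x - 1) Q := hg.indicator hE
  have hID : ∫ x, E.indicator (fun x ↦ f x - 1) x ∂Q = D := by
    rw [integral_indicator hE, integral_sub hf.integrableOn (integrable_const 1).integrableOn]
    simp [hD]
  have hI0 : ∫ x, (f x - 1) ∂Q = 0 := by
    rw [integral_sub hf (integrable_const 1), hf1]
    simp
  have hpos : 0 ≤ ∫ x, ((f x ^ 2 + (4 * D - 2) * (f x - 1)) + (4 * D ^ 2 - 1)
      - 8 * D * E.indicator (fun x ↦ f x - 1) x) ∂Q := by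
    refine integral_nonneg fun x ↦ ?_
    by_cases hx : x ∈ E
    · simp only [Pi.zero_apply, Set.indicator_of_mem hx]
      nlinarith [sq_nonneg (f x - 1 - 2 * D)]
    · simp only [Pi.zero_apply, Set.indicator_of_notMem hx]
      nlinarith [sq_nonneg (f x - 1 + 2 * D)]
  have hA : Integrable (fun x ↦ f x ^ 2 + (4 * D - 2) * (f x - 1)) Q := hf2.add (hg.const_mul _)
  have hB : Integrable (fun x ↦ f x ^ 2 + (4 * D - 2) * (f x - 1) + (4 * D ^ 2 - 1)) Q :=
    hA.add (integrable_const _)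
  rw [integral_sub hB (hgE.const_mul _), integral_add hA (integrable_const _),
    integral_add hf2 (hg.const_mul _), integral_const_mul, integral_const_mul, hID, hI0] at hpos
  simp only [integral_const, probReal_univ, smul_eq_mul] at hpos
  nlinarith

theorem four_mul_sq_pi_gaussianReal_sub_le {ι : Type*} [Fintype ι] (m₁ m₂ : ι → ℝ) {v : NNReal}
    (hv : v ≠ 0) {E : Set (ι → ℝ)} (hE : MeasurableSet E) :
    4 * ((Measure.pi fun i ↦ gaussianReal (m₁ i) v).real E -
        (Measure.pi fun i ↦ gaussianReal (m₂ i) v).real E) ^ 2 ≤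
      Real.exp (∑ i, (m₁ i - m₂ i) ^ 2 / v) - 1 := by
  let g : ι → ℝ → ℝ := fun i x ↦
    Real.exp ((m₁ i - m₂ i) / v * x - (m₁ i ^ 2 - m₂ i ^ 2) / (2 * v))
  have hg0 : ∀ i x, 0 ≤ g i x := fun i x ↦ (Real.exp_pos _).le
  have hgi : ∀ i, Integrable (g i) (gaussianReal (m₂ i) v) :=
    fun i ↦ integrable_exp_affine_gaussianReal _ _ _ _
  have hg2 : ∀ i, Integrable (fun x ↦ g i x ^ 2) (gaussianReal (m₂ i) v) := fun i ↦ by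
    simp only [g, ← Real.exp_nat_mul, mul_sub, ← mul_assoc]
    exact integrable_exp_affine_gaussianReal _ _ _ _
  have hPQ := pi_withDensity_ofReal (fun i ↦ gaussianReal (m₁ i) v)
    (fun i ↦ gaussianReal (m₂ i) v) g hg0 hgi
    fun i ↦ gaussianReal_eq_withDensity_gaussianReal _ _ hv
  have hf : Integrable (fun x : ι → ℝ ↦ ∏ i, g i (x i))
      (Measure.pi fun i ↦ gaussianReal (m₂ i) v) := Integrable.fintype_prod hgi
  have hreal : ∀ s : Set (ι → ℝ), MeasurableSet s →
      ∫ x in s, ∏ i, g i (x i) ∂(Measure.pi fun i ↦ gaussianReal (m₂ i) v) =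
        (Measure.pi fun i ↦ gaussianReal (m₁ i) v).real s := fun s hs ↦ by
    have h0 : ∀ x : ι → ℝ, 0 ≤ ∏ i, g i (x i) := fun x ↦ Finset.prod_nonneg fun i _ ↦ hg0 i _
    rw [hPQ, measureReal_def, withDensity_apply _ hs,
      ← ofReal_integral_eq_lintegral_ofReal hf.restrict (ae_of_all _ h0),
      ENNReal.toReal_ofReal (integral_nonneg h0)]
  have hf2 : Integrable (fun x : ι → ℝ ↦ (∏ i, g i (x i)) ^ 2)
      (Measure.pi fun i ↦ gaussianReal (m₂ i) v) := by
    simp_rw [← Finset.prod_pow]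
    exact Integrable.fintype_prod hg2
  have key := four_mul_sq_setIntegral_sub_measureReal_le _ hf hf2
    (by rw [← setIntegral_univ, hreal _ MeasurableSet.univ, probReal_univ]) hE
  simp_rw [hreal E hE, ← Finset.prod_pow] at key
  rwa [integral_fintype_prod_eq_prod (fun i x ↦ g i x ^ 2),
    Finset.prod_congr rfl fun i _ ↦ integral_sq_density_gaussianReal (m₁ i) (m₂ i) hv,
    ← Real.exp_sum] at key

theorem exp_sub_one_le_two_mul {x : ℝ} (h0 : 0 ≤ x) (h1 : x ≤ 1) :
    Real.exp x - 1 ≤ 2 * x := by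
  have h := Real.abs_exp_sub_one_sub_id_le (x := x) (by rwa [abs_of_nonneg h0])
  nlinarith [le_abs_self (Real.exp x - 1 - x)]

/-- TV-indistinguishability of the Gaussian mechanism: with
`σ² = ε²/(8 log(4d/δ))` and `‖μ₁ - μ₂‖_∞ ≤ ερ/√(8d log(4d/δ))`, the product Gaussians
`N(μ₁, σ²I_d)` and `N(μ₂, σ²I_d)` differ by at most `ρ/√2` on every Borel set. -/
theorem stmt_9 (d : ℕ) (hd : 1 ≤ d) (ε ρ δ : ℝ)
    (hε : ε ∈ Set.Ioo (0 : ℝ) 1) (hρ : ρ ∈ Set.Ioo (0 : ℝ) 1) (hδ : δ ∈ Set.Ioo (0 : ℝ) 1)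
    (μ₁ μ₂ : Fin d → ℝ)
    (hμ : ∀ i, |μ₁ i - μ₂ i| ≤ ε * ρ / Real.sqrt (8 * d * Real.log (4 * d / δ)))
    (E : Set (Fin d → ℝ)) (hE : MeasurableSet E) :
    |((Measure.pi fun i =>
          gaussianReal (μ₁ i) ((ε ^ 2 / (8 * Real.log (4 * d / δ))).toNNReal)) E).toReal -
        ((Measure.pi fun i =>
          gaussianReal (μ₂ i) ((ε ^ 2 / (8 * Real.log (4 * d / δ))).toNNReal)) E).toReal| ≤
      ρ / Real.sqrt 2 := by
  obtain ⟨hε0, hε1⟩ := hε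
  obtain ⟨hρ0, hρ1⟩ := hρ
  obtain ⟨hδ0, hδ1⟩ := hδ
  have hd' : (1 : ℝ) ≤ d := by exact_mod_cast hd
  have hL : 0 < Real.log (4 * d / δ) :=
    Real.log_pos (by rw [lt_div_iff₀ hδ0]; linarith)
  set L := Real.log (4 * d / δ)
  have hv : 0 < ε ^ 2 / (8 * L) := by positivity
  have hvN : (ε ^ 2 / (8 * L)).toNNReal ≠ 0 := (Real.toNNReal_pos.2 hv).ne'
  have hsum : ∑ i, (μ₁ i - μ₂ i) ^ 2 / ((ε ^ 2 / (8 * L)).toNNReal : ℝ) ≤ ρ ^ 2 := by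
    rw [Real.coe_toNNReal _ hv.le]
    calc ∑ i, (μ₁ i - μ₂ i) ^ 2 / (ε ^ 2 / (8 * L))
        ≤ ∑ _i : Fin d, (ε * ρ / Real.sqrt (8 * d * L)) ^ 2 / (ε ^ 2 / (8 * L)) := by
          gcongr ∑ _i, ?_ / _ with i
          rw [← sq_abs]
          exact pow_le_pow_left₀ (abs_nonneg _) (hμ i) 2
      _ = ρ ^ 2 := by
          rw [div_pow, Real.sq_sqrt (by positivity), Finset.sum_const, Finset.card_univ,
            Fintype.card_fin, nsmul_eq_mul]
          field_simp
  have key := four_mul_sq_pi_gaussianReal_sub_le μ₁ μ₂ hvN hE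
  have hexp := exp_sub_one_le_two_mul (sq_nonneg ρ) (by nlinarith)
  refine abs_le_of_sq_le_sq ?_ (by positivity)
  rw [div_pow, Real.sq_sqrt zero_le_two]
  have := Real.exp_le_exp.2 hsum
  simp only [measureReal_def] at key
  linarith
end
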